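/- For every m, n, b ∈ ℕ with m, n, b ≥ 1, there exists a b-invisible n×m forest; that is, there exist natural numbers r, s ≥ 1 such that for all 0 ≤ i ≤ n−1 and 0 ≤ j ≤ m−1 the point (r+i, s+j) is b-invisible: there exists an integer k > 1 with k ∣ (r+i) and k^b ∣ (s+j). -/

import Mathlib

open Function in
/-- Pairwise coprime moduli can simultaneously divide prescribed positive shifts of one number. -/
theorem exists_pos_forall_dvd_add {ι : Type*} (t : Finset ι) (f q : ι → ℕ)
    (hq : ∀ x ∈ t, q x ≠ 0) (hc : Set.Pairwise (t : Set ι) (Nat.Coprime on q)) :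
    ∃ r : ℕ, 1 ≤ r ∧ ∀ x ∈ t, q x ∣ r + f x := by
  obtain ⟨r, hr⟩ := Nat.chineseRemainderOfFinset (fun x => (q x - 1) * f x) q t hq hc
  refine ⟨r + ∏ x ∈ t, q x, ?_, fun x hx => ?_⟩
  · exact le_add_left (Nat.one_le_iff_ne_zero.mpr (Finset.prod_ne_zero_iff.mpr hq))
  · have hshift : (q x - 1) * f x + f x = q x * f x := by
      rw [← Nat.succ_mul, Nat.succ_eq_add_one,
        Nat.sub_add_cancel (Nat.one_le_iff_ne_zero.mpr (hq x hx))]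
    have hdvd : q x ∣ r + f x :=
      (((hr x hx).add_right (f x)).dvd_iff dvd_rfl).mpr (hshift ▸ dvd_mul_right _ _)
    rw [add_right_comm]
    exact dvd_add hdvd (Finset.dvd_prod_of_mem q hx)

/-- For every `m, n, b ≥ 1` there exists a `b`-invisible `n × m` forest:
natural numbers `r, s ≥ 1` such that for all `0 ≤ i ≤ n-1` and `0 ≤ j ≤ m-1`
there is an integer `k > 1` with `k ∣ r + i` and `k ^ b ∣ s + j`. -/
theorem exists_b_invisible_forest (m n b : ℕ) (hm : 1 ≤ m) (hn : 1 ≤ n)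
    (hb : 1 ≤ b) :
    ∃ r s : ℕ, 1 ≤ r ∧ 1 ≤ s ∧
      ∀ i j : ℕ, i ≤ n - 1 → j ≤ m - 1 →
        ∃ k : ℕ, 1 < k ∧ k ∣ (r + i) ∧ k ^ b ∣ (s + j) := by
  let p : ℕ × ℕ → ℕ := fun x => Nat.nth Nat.Prime (Nat.pair x.1 x.2)
  have hp (x : ℕ × ℕ) : (p x).Prime := Nat.prime_nth_prime _
  have hcop {x y : ℕ × ℕ} (hxy : x ≠ y) : (p x).Coprime (p y) := by
    refine (Nat.coprime_primes (hp x) (hp y)).mpr fun h => hxy ?_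
    exact Nat.pairEquiv.injective (Nat.nth_injective Nat.infinite_setOfPred_prime h)
  let t := Finset.range n ×ˢ Finset.range m
  obtain ⟨r, hr, hri⟩ := exists_pos_forall_dvd_add t Prod.fst p
    (fun x _ => (hp x).ne_zero) (fun _ _ _ _ hxy => hcop hxy)
  obtain ⟨s, hs, hsj⟩ := exists_pos_forall_dvd_add t Prod.snd (fun x => p x ^ b)
    (fun x _ => pow_ne_zero b (hp x).ne_zero)
    (fun _ _ _ _ hxy => Nat.Coprime.pow b b (hcop hxy))
  refine ⟨r, s, hr, hs, fun i j hi hj => ?_⟩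
  have hmem : (i, j) ∈ t :=
    Finset.mk_mem_product (Finset.mem_range.mpr (by lia)) (Finset.mem_range.mpr (by lia))
  exact ⟨p (i, j), (hp _).one_lt, hri _ hmem, hsj _ hmem⟩
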